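/- arXiv:2002.06236 — 4 statements merged into one kernel-verified Lean document; each statement's English description precedes it below -/
import Mathlib

section
/- Let T be a quasi-multiplication operator on a complex Banach space X such that 1 ∈ σ(T) and σ(T) ⊆ 𝔻 ∪ {1}. Define m(ε) = max_{ε≤|θ|≤π} 1/dist(e^{iθ},σ(T)) and m_max(ε) = max_{ε≤θ≤π} m(θ) log(θ/ε) for ε ∈ (0,π]. Suppose δ ∈ (0,1] is such that min_{ε≤|θ|≤π} dist(e^{iθ},σ(T)) ≤ δε for all sufficiently small ε ∈ (0,π]. Then ‖Tⁿ(I − T)‖ ≤ (1 + δ) m_max⁻¹(n) for all sufficiently large n ≥ 1. -/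
open Filter Topology

/-- The right inverse `M⁻¹(s) = inf {ε ∈ (0,π] : M ε ≤ s}` of a continuous
non-increasing function `M : (0,π] → (0,∞)`. -/
noncomputable def rightInv (M : ℝ → ℝ) (s : ℝ) : ℝ :=
  sInf {ε : ℝ | ε ∈ Set.Ioc 0 Real.pi ∧ M ε ≤ s}

/-- `T` is a quasi-multiplication operator: `‖p(T) q(T)⁻¹‖ = sup_{λ ∈ σ(T)} |p(λ)/q(λ)|`
for all polynomials `p, q` with `q` having no zeros on `σ(T)`. -/
def IsQuasiMultiplication {X : Type*} [NormedAddCommGroup X] [NormedSpace ℂ X]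
    (T : X →L[ℂ] X) : Prop :=
  ∀ p q : Polynomial ℂ, (∀ z ∈ spectrum ℂ T, q.eval z ≠ 0) →
    IsUnit (Polynomial.aeval T q) ∧
      ‖Polynomial.aeval T p * Ring.inverse (Polynomial.aeval T q)‖ =
        sSup ((fun z : ℂ => ‖p.eval z / q.eval z‖) '' spectrum ℂ T)

/-- `m(ε) = max_{ε ≤ |θ| ≤ π} 1 / dist(e^{iθ}, S)`. -/
noncomputable def mDist (S : Set ℂ) (ε : ℝ) : ℝ :=
  sSup ((fun θ : ℝ => (Metric.infDist (Complex.exp (Complex.I * θ)) S)⁻¹) ''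
    {θ : ℝ | ε ≤ |θ| ∧ |θ| ≤ Real.pi})

/-- `m_max(ε) = max_{ε ≤ θ ≤ π} m(θ) log(θ/ε)`. -/
noncomputable def mMax (m : ℝ → ℝ) (ε : ℝ) : ℝ :=
  sSup ((fun θ : ℝ => m θ * Real.log (θ / ε)) '' Set.Icc ε Real.pi)

section UpperBound

variable {S : Set ℂ}

lemma infDist_exp_pos (hc : IsClosed S) (h1 : (1 : ℂ) ∈ S)
    (hS : S ⊆ Metric.ball (0 : ℂ) 1 ∪ {1}) {θ : ℝ} (h0 : 0 < |θ|) (hπ : |θ| ≤ Real.pi) :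
    0 < Metric.infDist (Complex.exp (Complex.I * θ)) S := by
  refine (hc.notMem_iff_infDist_pos ⟨1, h1⟩).1 fun hmem => ?_
  rcases hS hmem with h | h
  · rw [mem_ball_zero_iff, mul_comm, Complex.norm_exp_ofReal_mul_I] at h
    exact lt_irrefl _ h
  · have h' : Complex.exp (Complex.I * θ) = 1 := h
    rw [Complex.exp_eq_one_iff] at h'
    obtain ⟨k, hk⟩ := h'
    have hk' : θ = k * (2 * Real.pi) := by
      have := congrArg Complex.im hk
      simpa using this
    rw [hk', abs_mul, abs_of_pos Real.two_pi_pos] at h0 hπ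
    have hkne : k ≠ 0 := by
      rintro rfl
      simp at h0
    have : (1 : ℝ) ≤ |(k : ℝ)| := by exact_mod_cast Int.one_le_abs hkne
    nlinarith [Real.pi_pos]

lemma bddAbove_inv_infDist (hc : IsClosed S) (h1 : (1 : ℂ) ∈ S)
    (hS : S ⊆ Metric.ball (0 : ℂ) 1 ∪ {1}) {ε : ℝ} (hε : 0 < ε) :
    BddAbove ((fun θ : ℝ => (Metric.infDist (Complex.exp (Complex.I * θ)) S)⁻¹) ''
      {θ : ℝ | ε ≤ |θ| ∧ |θ| ≤ Real.pi}) := by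
  have hK : IsCompact {θ : ℝ | ε ≤ |θ| ∧ |θ| ≤ Real.pi} := by
    refine (isCompact_Icc (a := -Real.pi) (b := Real.pi)).of_isClosed_subset ?_
      fun θ hθ => abs_le.1 hθ.2
    exact (isClosed_le continuous_const continuous_abs).inter
      (isClosed_le continuous_abs continuous_const)
  refine hK.bddAbove_image (ContinuousOn.inv₀ ?_ fun θ hθ =>
    (infDist_exp_pos hc h1 hS (hε.trans_le hθ.1) hθ.2).ne')
  exact ((Metric.continuous_infDist_pt S).comp (by fun_prop)).continuousOn

lemma inv_infDist_le_mDist (hc : IsClosed S) (h1 : (1 : ℂ) ∈ S)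
    (hS : S ⊆ Metric.ball (0 : ℂ) 1 ∪ {1}) {ε θ : ℝ} (hε : 0 < ε) (hθ : ε ≤ |θ|)
    (hπ : |θ| ≤ Real.pi) :
    (Metric.infDist (Complex.exp (Complex.I * θ)) S)⁻¹ ≤ mDist S ε :=
  le_csSup (bddAbove_inv_infDist hc h1 hS hε) ⟨θ, ⟨hθ, hπ⟩, rfl⟩

lemma mDist_antitone (hc : IsClosed S) (h1 : (1 : ℂ) ∈ S)
    (hS : S ⊆ Metric.ball (0 : ℂ) 1 ∪ {1}) {ε η : ℝ} (hε : 0 < ε) (h : ε ≤ η)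
    (hη : η ≤ Real.pi) : mDist S η ≤ mDist S ε := by
  refine csSup_le_csSup (bddAbove_inv_infDist hc h1 hS hε) ?_
    (Set.image_mono fun θ hθ => ⟨h.trans hθ.1, hθ.2⟩)
  exact ⟨_, Real.pi, ⟨by rwa [abs_of_pos Real.pi_pos], (abs_of_pos Real.pi_pos).le⟩, rfl⟩

lemma mDist_nonneg (ε : ℝ) : 0 ≤ mDist S ε := by
  refine Real.sSup_nonneg ?_
  rintro _ ⟨θ, -, rfl⟩
  exact inv_nonneg.2 Metric.infDist_nonneg

lemma mul_log_le_mMax (hc : IsClosed S) (h1 : (1 : ℂ) ∈ S)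
    (hS : S ⊆ Metric.ball (0 : ℂ) 1 ∪ {1}) {ε θ : ℝ} (hε : 0 < ε) (hθ : ε ≤ θ)
    (hπ : θ ≤ Real.pi) : mDist S θ * Real.log (θ / ε) ≤ mMax (mDist S) ε := by
  refine le_csSup ⟨mDist S ε * Real.log (Real.pi / ε), ?_⟩ ⟨θ, ⟨hθ, hπ⟩, rfl⟩
  rintro _ ⟨η, ⟨hη, hηπ⟩, rfl⟩
  have hη0 := hε.trans_le hη
  refine mul_le_mul (mDist_antitone hc h1 hS hε hη hηπ) ?_
    (Real.log_nonneg ((one_le_div hε).2 hη)) (mDist_nonneg ε)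
  gcongr

/-- Splitting `|1 - z| ≤ |arg z| + (1 - |z|)`, the first part is controlled by `mMax` and the
second one by the lower bound on `n`. -/
lemma norm_pow_mul_one_sub_le (hc : IsClosed S) (h1 : (1 : ℂ) ∈ S)
    (hS : S ⊆ Metric.ball (0 : ℂ) 1 ∪ {1}) {ε δ : ℝ} (hε : 0 < ε) {n : ℕ}
    (hn : mMax (mDist S) ε ≤ n) (hnδ : 1 ≤ n * (δ * (Real.exp 1 * ε))) {z : ℂ} (hz : z ∈ S) :
    ‖z ^ n * (1 - z)‖ ≤ (1 + δ) * ε := by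
  set r := ‖z‖ with hr
  set θ := z.arg with hθ
  have hzr : (r : ℂ) * Complex.exp (Complex.I * θ) = z := by
    rw [mul_comm Complex.I]
    exact Complex.norm_mul_exp_arg_mul_I z
  have hunit : ‖Complex.exp (Complex.I * θ)‖ = 1 := by
    rw [mul_comm, Complex.norm_exp_ofReal_mul_I]
  have hr0 : 0 ≤ r := norm_nonneg z
  have hr1 : r ≤ 1 := by
    rcases hS hz with h | h
    · exact (mem_ball_zero_iff.1 h).le
    · rw [hr, Set.mem_singleton_iff.1 h, norm_one]
  have hdist : ‖Complex.exp (Complex.I * θ) - z‖ = 1 - r := by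
    have : Complex.exp (Complex.I * θ) - z
        = ((1 - r : ℝ) : ℂ) * Complex.exp (Complex.I * θ) := by
      conv_lhs => rw [← hzr]
      push_cast
      ring
    rw [this, norm_mul, hunit, mul_one, Complex.norm_real, Real.norm_of_nonneg (by linarith)]
  have htri : ‖1 - z‖ ≤ |θ| + (1 - r) := by
    have h := norm_sub_le_norm_sub_add_norm_sub (1 : ℂ) (Complex.exp (Complex.I * θ)) z
    rw [hdist, norm_sub_rev 1 (Complex.exp _)] at h
    have h' := Real.norm_exp_I_mul_ofReal_sub_one_le (x := θ)
    rw [Real.norm_eq_abs] at h'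
    linarith
  have hpow : r ^ n ≤ Real.exp (-(n * (1 - r))) := by
    have h : r ≤ Real.exp (-(1 - r)) := by
      have := Real.add_one_le_exp (-(1 - r))
      linarith
    calc r ^ n ≤ Real.exp (-(1 - r)) ^ n := pow_le_pow_left₀ hr0 h n
      _ = Real.exp (-(n * (1 - r))) := by
        rw [← Real.exp_nat_mul]
        ring_nf
  have hangle : r ^ n * |θ| ≤ ε := by
    rcases le_or_gt |θ| ε with h | h
    · calc r ^ n * |θ| ≤ 1 * |θ| := by
            gcongr
            exact pow_le_one₀ hr0 hr1
        _ ≤ ε := by linarith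
    · have hθ0 : 0 < |θ| := hε.trans h
      have hθπ : |θ| ≤ Real.pi := Complex.abs_arg_le_pi z
      have hpos := infDist_exp_pos hc h1 hS hθ0 hθπ
      have hle : Metric.infDist (Complex.exp (Complex.I * θ)) S ≤ 1 - r := by
        rw [← hdist, ← dist_eq_norm]
        exact Metric.infDist_le_dist_of_mem hz
      have hx : 0 < 1 - r := hpos.trans_le hle
      have hm : (1 - r)⁻¹ ≤ mDist S |θ| :=
        (inv_anti₀ hpos hle).trans (inv_infDist_le_mDist hc h1 hS hθ0 le_rfl hθπ)
      have hlog : 0 ≤ Real.log (|θ| / ε) := Real.log_nonneg ((one_le_div hε).2 h.le)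
      have hlogn : Real.log (|θ| / ε) ≤ n * (1 - r) := by
        have h2 : (1 - r)⁻¹ * Real.log (|θ| / ε) ≤ n :=
          (mul_le_mul_of_nonneg_right hm hlog).trans
            ((mul_log_le_mMax hc h1 hS hε h.le hθπ).trans hn)
        rwa [inv_mul_le_iff₀ hx, mul_comm] at h2
      have hexp : |θ| ≤ Real.exp (n * (1 - r)) * ε := by
        rwa [Real.log_le_iff_le_exp (by positivity), div_le_iff₀ hε] at hlogn
      calc r ^ n * |θ| ≤ Real.exp (-(n * (1 - r))) * (Real.exp (n * (1 - r)) * ε) := by gcongr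
        _ = ε := by rw [← mul_assoc, ← Real.exp_add]; simp
  have hradius : r ^ n * (1 - r) ≤ δ * ε := by
    have hn0 : (0 : ℝ) < n := by
      rcases Nat.eq_zero_or_pos n with h | h
      · subst h
        norm_num at hnδ
      · exact_mod_cast h
    have h2 : n * (1 - r) ≤ Real.exp (n * (1 - r)) * Real.exp (-1) := by
      rw [← Real.exp_add]
      have := Real.add_one_le_exp (n * (1 - r) + -1)
      linarith
    have h3 : n * (r ^ n * (1 - r)) ≤ n * (δ * ε) := by
      calc n * (r ^ n * (1 - r)) = r ^ n * (n * (1 - r)) := by ring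
        _ ≤ Real.exp (-(n * (1 - r))) * (Real.exp (n * (1 - r)) * Real.exp (-1)) := by
          have : 0 ≤ 1 - r := by linarith
          gcongr
        _ = Real.exp (-1) * 1 := by rw [← mul_assoc, ← Real.exp_add]; simp
        _ ≤ Real.exp (-1) * (n * (δ * (Real.exp 1 * ε))) := by gcongr
        _ = (Real.exp (-1) * Real.exp 1) * (n * (δ * ε)) := by ring
        _ = n * (δ * ε) := by rw [← Real.exp_add]; simp
    exact le_of_mul_le_mul_left h3 hn0
  calc ‖z ^ n * (1 - z)‖ = r ^ n * ‖1 - z‖ := by rw [norm_mul, norm_pow]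
    _ ≤ r ^ n * (|θ| + (1 - r)) := by gcongr
    _ ≤ (1 + δ) * ε := by linarith

end UpperBound

lemma IsQuasiMultiplication.norm_pow_mul_one_sub {X : Type*} [NormedAddCommGroup X]
    [NormedSpace ℂ X] {T : X →L[ℂ] X} (hT : IsQuasiMultiplication T) (n : ℕ) :
    ‖T ^ n * (1 - T)‖ = sSup ((fun z : ℂ => ‖z ^ n * (1 - z)‖) '' spectrum ℂ T) := by
  have h := (hT (Polynomial.X ^ n * (1 - Polynomial.X)) 1 (by simp)).2
  simpa using h

/-- Upper bound for quasi-multiplication operators: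
`‖Tⁿ(I-T)‖ ≤ (1+δ) m_max⁻¹(n)` for all sufficiently large `n`. -/
theorem quasiMult_upper_bound {X : Type*} [NormedAddCommGroup X] [NormedSpace ℂ X]
    [CompleteSpace X] (T : X →L[ℂ] X)
    (hQM : IsQuasiMultiplication T)
    (h1 : (1:ℂ) ∈ spectrum ℂ T)
    (hσ : spectrum ℂ T ⊆ Metric.ball (0:ℂ) 1 ∪ {1})
    (δ : ℝ) (hδ : δ ∈ Set.Ioc (0:ℝ) 1)
    (hmin : ∀ᶠ ε in nhdsWithin (0:ℝ) (Set.Ioi 0), ∃ θ : ℝ, ε ≤ |θ| ∧ |θ| ≤ Real.pi ∧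
      Metric.infDist (Complex.exp (Complex.I * θ)) (spectrum ℂ T) ≤ δ * ε) :
    ∀ᶠ n : ℕ in Filter.atTop,
      ‖T ^ n * (1 - T)‖ ≤ (1 + δ) * rightInv (mMax (mDist (spectrum ℂ T))) n := by
  have hc : IsClosed (spectrum ℂ T) := spectrum.isClosed T
  obtain ⟨ε₁, hε₁, hsmall⟩ := mem_nhdsGT_iff_exists_Ioo_subset.1 hmin
  rw [Set.mem_Ioi] at hε₁
  set ε₀ := min (ε₁ / 2) Real.pi / Real.exp 1 with hε₀
  have hε₀pos : 0 < ε₀ := by have := Real.pi_pos; positivity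
  have hmulε₀ : Real.exp 1 * ε₀ = min (ε₁ / 2) Real.pi := by rw [hε₀]; field_simp
  have hbound : ∀ (n : ℕ) (ε : ℝ), 0 < ε → ε ≤ ε₀ → mMax (mDist (spectrum ℂ T)) ε ≤ n →
      ‖T ^ n * (1 - T)‖ ≤ (1 + δ) * ε := by
    intro n ε hε hεε₀ hn
    have hle : Real.exp 1 * ε ≤ min (ε₁ / 2) Real.pi := by
      rw [← hmulε₀]
      gcongr
    have heε : 0 < Real.exp 1 * ε := by positivity
    have hlt : Real.exp 1 * ε < ε₁ := by linarith [hle.trans (min_le_left _ _)]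
    obtain ⟨θ, hθ, hθπ, hθδ⟩ := hsmall ⟨heε, hlt⟩
    have hpos := infDist_exp_pos hc h1 hσ (heε.trans_le hθ) hθπ
    have hm := inv_infDist_le_mDist hc h1 hσ heε hθ hθπ
    have hmax := mul_log_le_mMax hc h1 hσ hε
      (le_mul_of_one_le_left hε.le (Real.one_le_exp zero_le_one)) (hle.trans (min_le_right _ _))
    rw [mul_div_cancel_right₀ _ hε.ne', Real.log_exp, mul_one] at hmax
    have hinv := (inv_anti₀ hpos hθδ).trans (hm.trans (hmax.trans hn))
    rw [inv_le_iff_one_le_mul₀ (hpos.trans_le hθδ)] at hinv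
    rw [hQM.norm_pow_mul_one_sub n]
    refine csSup_le ⟨_, 1, h1, rfl⟩ ?_
    rintro _ ⟨z, hz, rfl⟩
    exact norm_pow_mul_one_sub_le hc h1 hσ hε hn hinv hz
  have hε₀π : ε₀ ≤ Real.pi :=
    (le_mul_of_one_le_left hε₀pos.le (Real.one_le_exp zero_le_one)).trans
      (hmulε₀.trans_le (min_le_right _ _))
  have hδ0 : 0 < 1 + δ := by linarith [hδ.1]
  filter_upwards [tendsto_natCast_atTop_atTop.eventually_ge_atTop
    (mMax (mDist (spectrum ℂ T)) ε₀)] with n hn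
  rw [← div_le_iff₀' hδ0]
  refine le_csInf ⟨ε₀, ⟨hε₀pos, hε₀π⟩, hn⟩ ?_
  rintro ε ⟨⟨hε, -⟩, hεn⟩
  rw [div_le_iff₀' hδ0]
  rcases le_total ε ε₀ with h | h
  · exact hbound n ε hε h hεn
  · exact (hbound n ε₀ hε₀pos le_rfl hn).trans (by gcongr)
end

section
/- Let m : (0,π] → (0,∞) be continuous and non-increasing, and suppose there exist α ≥ 1, c_α > 0 and ε₁ ∈ (0,π] such that m(ε) ≥ c_α ε^{−α} for all ε ∈ (0,ε₁]. Then for every c ∈ (0, 1 + α) there exists ε₂ ∈ (0,π] such that m_max(ε) ≤ c⁻¹ m_log(ε) for all ε ∈ (0,ε₂]; consequently m_max⁻¹(n) ≤ m_log⁻¹(cn) for all sufficiently large n. -/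
open Filter Topology

/-- `m_log(ε) = m(ε) log(1 + m(ε)/ε)`. -/
noncomputable def mLog (m : ℝ → ℝ) (ε : ℝ) : ℝ :=
  m ε * Real.log (1 + m ε / ε)

/-- A power lower bound on `m` makes `c log(π/ε)` at most `log(1 + m(ε)/ε)` for small `ε`. -/
lemma exists_mul_log_pi_div_le_log_one_add (m : ℝ → ℝ) {α cα ε₁ c : ℝ} (hcα : 0 < cα)
    (hε₁ : ε₁ ∈ Set.Ioc (0:ℝ) Real.pi)
    (hlb : ∀ ε ∈ Set.Ioc (0:ℝ) ε₁, cα * ε ^ (-α) ≤ m ε) (hc : c < 1 + α) :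
    ∃ ε₂ ∈ Set.Ioc (0:ℝ) Real.pi, ∀ ε ∈ Set.Ioc (0:ℝ) ε₂,
      c * Real.log (Real.pi / ε) ≤ Real.log (1 + m ε / ε) := by
  set L := (c * Real.log Real.pi - Real.log cα) / (1 + α - c) with hL
  refine ⟨min ε₁ (Real.exp (-L)), ⟨lt_min hε₁.1 (Real.exp_pos _), (min_le_left _ _).trans hε₁.2⟩,
    fun ε hε => ?_⟩
  have hε0 := hε.1
  have hlogε : Real.log ε ≤ -L :=
    (Real.log_le_iff_le_exp hε0).2 (hε.2.trans (min_le_right _ _))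
  have hpow : 0 < cα * ε ^ (-α) := mul_pos hcα (Real.rpow_pos_of_pos hε0 _)
  have hm := hlb ε ⟨hε0, hε.2.trans (min_le_left _ _)⟩
  have hlog : Real.log (cα * ε ^ (-α) / ε) = Real.log cα - (1 + α) * Real.log ε := by
    rw [Real.log_div hpow.ne' hε0.ne', Real.log_mul hcα.ne' (Real.rpow_pos_of_pos hε0 _).ne',
      Real.log_rpow hε0]
    ring
  have hle : Real.log (cα * ε ^ (-α) / ε) ≤ Real.log (1 + m ε / ε) := by
    refine Real.log_le_log (div_pos hpow hε0) ?_
    have : cα * ε ^ (-α) / ε ≤ m ε / ε := by gcongr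
    linarith
  have hLmul : c * Real.log Real.pi - Real.log cα ≤ -Real.log ε * (1 + α - c) :=
    (div_le_iff₀ (by linarith)).1 (by linarith)
  rw [Real.log_div Real.pi_ne_zero hε0.ne']
  linarith

/-- For antitone positive `m`, the maximum `m_max(ε)` is at most `m(ε) log(π/ε)`. -/
lemma mMax_le_mul_log_pi_div {m : ℝ → ℝ} (hmanti : AntitoneOn m (Set.Ioc 0 Real.pi))
    (hmpos : ∀ ε ∈ Set.Ioc (0:ℝ) Real.pi, 0 < m ε) {ε : ℝ} (hε : ε ∈ Set.Ioc (0:ℝ) Real.pi) :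
    mMax m ε ≤ m ε * Real.log (Real.pi / ε) := by
  refine csSup_le ((Set.nonempty_Icc.2 hε.2).image _) ?_
  rintro _ ⟨θ, hθ, rfl⟩
  have hε0 := hε.1
  have hθ0 : 0 < θ := hε0.trans_le hθ.1
  have hlog : 0 ≤ Real.log (θ / ε) := Real.log_nonneg ((one_le_div hε0).2 hθ.1)
  have hlog' : Real.log (θ / ε) ≤ Real.log (Real.pi / ε) :=
    Real.log_le_log (div_pos hθ0 hε0) (div_le_div_of_nonneg_right hθ.2 hε0.le)
  exact mul_le_mul (hmanti hε ⟨hθ0, hθ.2⟩ hθ.1) hlog' hlog (hmpos ε hε).le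

/-- If `F ≤ c⁻¹ G` near `0`, then `F⁻¹(s) ≤ G⁻¹(cs)` for all large `s`. -/
lemma rightInv_le_rightInv_mul {F G : ℝ → ℝ} {c ε₂ s : ℝ} (hc : 0 < c)
    (hε₂ : ε₂ ∈ Set.Ioc (0:ℝ) Real.pi) (hFG : ∀ ε ∈ Set.Ioc (0:ℝ) ε₂, F ε ≤ c⁻¹ * G ε)
    (hF : F ε₂ ≤ s) (hG : G Real.pi ≤ c * s) : rightInv F s ≤ rightInv G (c * s) := by
  have hbdd : BddBelow {ε : ℝ | ε ∈ Set.Ioc 0 Real.pi ∧ F ε ≤ s} := ⟨0, fun x hx => hx.1.1.le⟩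
  refine le_csInf ⟨Real.pi, ⟨Real.pi_pos, le_rfl⟩, hG⟩ fun ε hε => ?_
  rcases le_total ε ε₂ with h | h
  · exact csInf_le hbdd ⟨hε.1, (hFG ε ⟨hε.1.1, h⟩).trans ((inv_mul_le_iff₀ hc).2 hε.2)⟩
  · exact (csInf_le hbdd ⟨hε₂, hF⟩).trans h

/-- If `m(ε) ≥ c_α ε^{-α}` near `0` for some `α ≥ 1`, then for every `c ∈ (0, 1+α)` one has
`m_max ≤ c⁻¹ m_log` near `0`, and consequently `m_max⁻¹(n) ≤ m_log⁻¹(cn)` for large `n`. -/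
theorem mMax_le_mLog (m : ℝ → ℝ)
    (hmc : ContinuousOn m (Set.Ioc 0 Real.pi))
    (hmanti : AntitoneOn m (Set.Ioc 0 Real.pi))
    (hmpos : ∀ ε ∈ Set.Ioc (0:ℝ) Real.pi, 0 < m ε)
    (α : ℝ) (hα : 1 ≤ α) (cα : ℝ) (hcα : 0 < cα)
    (ε₁ : ℝ) (hε₁ : ε₁ ∈ Set.Ioc (0:ℝ) Real.pi)
    (hlb : ∀ ε ∈ Set.Ioc (0:ℝ) ε₁, cα * ε ^ (-α) ≤ m ε) :
    ∀ c ∈ Set.Ioo (0:ℝ) (1 + α),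
      (∃ ε₂ ∈ Set.Ioc (0:ℝ) Real.pi, ∀ ε ∈ Set.Ioc (0:ℝ) ε₂,
        mMax m ε ≤ c⁻¹ * mLog m ε) ∧
      (∃ N : ℕ, ∀ n : ℕ, N ≤ n → rightInv (mMax m) n ≤ rightInv (mLog m) (c * n)) := by
  rintro c ⟨hc0, hc⟩
  obtain ⟨ε₂, hε₂, hlog⟩ := exists_mul_log_pi_div_le_log_one_add m hcα hε₁ hlb hc
  have hmax : ∀ ε ∈ Set.Ioc (0:ℝ) ε₂, mMax m ε ≤ c⁻¹ * mLog m ε := by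
    intro ε hε
    have hεπ : ε ∈ Set.Ioc (0:ℝ) Real.pi := ⟨hε.1, hε.2.trans hε₂.2⟩
    refine (mMax_le_mul_log_pi_div hmanti hmpos hεπ).trans ((le_inv_mul_iff₀ hc0).2 ?_)
    rw [mLog, mul_left_comm]
    exact mul_le_mul_of_nonneg_left (hlog ε hε) (hmpos ε hεπ).le
  refine ⟨⟨ε₂, hε₂, hmax⟩, ?_⟩
  obtain ⟨N, hN⟩ := exists_nat_ge (max (mMax m ε₂) (mLog m Real.pi / c))
  refine ⟨N, fun n hn => ?_⟩
  have hNn := hN.trans (Nat.cast_le.2 hn)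
  exact rightInv_le_rightInv_mul hc0 hε₂ hmax ((le_max_left _ _).trans hNn)
    ((div_le_iff₀' hc0).1 ((le_max_right _ _).trans hNn))
end

section
/- Let m : (0,π] → (0,∞) be continuous and non-increasing with m(ε) → ∞ as ε → 0+, and suppose m has reciprocally positive increase with constants c ∈ (0,1], α > 0 and ε₀ ∈ (0,π], i.e. m(ε/t)/m(ε) ≥ c tᵅ for all t ≥ 1 and ε ∈ (0,ε₀]. Then m_max(ε) ≤ (cαe)⁻¹ m(ε) for all sufficiently small ε ∈ (0,π]; consequently m_max⁻¹(n) = O(m⁻¹(n)) as n → ∞. -/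
open Filter Topology

/-- The maximum of `log t / t ^ α` over `t > 0` is `1 / (α e)`. -/
lemma log_le_rpow_div_mul_exp_one {α t : ℝ} (hα : 0 < α) (ht : 0 < t) :
    Real.log t ≤ t ^ α / (α * Real.exp 1) := by
  have hpow : 0 < t ^ α := Real.rpow_pos_of_pos ht α
  have h := Real.log_le_sub_one_of_pos (div_pos hpow (Real.exp_pos 1))
  rw [Real.log_div hpow.ne' (Real.exp_pos 1).ne', Real.log_exp, Real.log_rpow ht] at h
  rw [← div_div, div_right_comm, le_div_iff₀ hα]
  linarith

lemma eventually_log_div_le_rpow {a α b : ℝ} (ha : 0 < a) (hα : 0 < α) (hb : 0 < b) :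
    ∀ᶠ ε in 𝓝[>] (0 : ℝ), Real.log (a / ε) ≤ b * (a / ε) ^ α := by
  have hlim : Tendsto (fun ε : ℝ => a / ε) (𝓝[>] 0) atTop := by
    simpa only [div_eq_mul_inv] using tendsto_inv_nhdsGT_zero.const_mul_atTop ha
  filter_upwards [hlim.eventually ((isLittleO_log_rpow_atTop hα).bound hb),
    self_mem_nhdsWithin] with ε h hε
  have hpow : 0 ≤ (a / ε) ^ α := Real.rpow_nonneg (div_pos ha hε).le α
  rw [Real.norm_of_nonneg hpow] at h
  exact (Real.le_norm_self _).trans h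

lemma rightInv_le {M : ℝ → ℝ} {s ε : ℝ} (hε : ε ∈ Set.Ioc 0 Real.pi) (h : M ε ≤ s) :
    rightInv M s ≤ ε :=
  csInf_le ⟨0, fun _ hx => hx.1.1.le⟩ ⟨hε, h⟩

/-- Reciprocally positive increase of `m`, in product form. -/
lemma rpow_mul_le_of_recipPosIncrease {m : ℝ → ℝ} {c α ε₀ : ℝ} (hε₀ : ε₀ ≤ Real.pi)
    (hmpos : ∀ ε ∈ Set.Ioc (0:ℝ) Real.pi, 0 < m ε)
    (hrpi : ∀ t ≥ (1:ℝ), ∀ ε ∈ Set.Ioc (0:ℝ) ε₀, c * t ^ α ≤ m (ε / t) / m ε)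
    {ε θ : ℝ} (hε : 0 < ε) (hεθ : ε ≤ θ) (hθ : θ ≤ ε₀) :
    c * (θ / ε) ^ α * m θ ≤ m ε := by
  have hθ0 : 0 < θ := hε.trans_le hεθ
  have h := hrpi (θ / ε) ((one_le_div hε).2 hεθ) θ ⟨hθ0, hθ⟩
  rwa [div_div_cancel₀ hθ0.ne', le_div_iff₀ (hmpos θ ⟨hθ0, hθ.trans hε₀⟩)] at h

lemma eventually_mMax_le {m : ℝ → ℝ} {c α ε₀ : ℝ}
    (hmanti : AntitoneOn m (Set.Ioc 0 Real.pi))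
    (hmpos : ∀ ε ∈ Set.Ioc (0:ℝ) Real.pi, 0 < m ε)
    (hc : 0 < c) (hα : 0 < α) (hε₀ : ε₀ ∈ Set.Ioc (0:ℝ) Real.pi)
    (hrpi : ∀ t ≥ (1:ℝ), ∀ ε ∈ Set.Ioc (0:ℝ) ε₀, c * t ^ α ≤ m (ε / t) / m ε) :
    ∀ᶠ ε in 𝓝[>] (0 : ℝ), mMax m ε ≤ (c * α * Real.exp 1)⁻¹ * m ε := by
  obtain ⟨hε₀0, hε₀π⟩ := hε₀
  have hαe : 0 < α * Real.exp 1 := mul_pos hα (Real.exp_pos 1)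
  have hb : 0 < (ε₀ / Real.pi) ^ α / (α * Real.exp 1) :=
    div_pos (Real.rpow_pos_of_pos (div_pos hε₀0 Real.pi_pos) α) hαe
  filter_upwards [eventually_log_div_le_rpow Real.pi_pos hα hb,
    Ioc_mem_nhdsGT hε₀0] with ε hlog hε
  obtain ⟨hε0, hεε₀⟩ := hε
  have hreduce : ∀ θ, ε ≤ θ → θ ≤ ε₀ → ∀ L, L ≤ (θ / ε) ^ α / (α * Real.exp 1) →
      m θ * L ≤ (c * α * Real.exp 1)⁻¹ * m ε := by
    intro θ h₁ h₂ L hL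
    have hθ := hmpos θ ⟨hε0.trans_le h₁, h₂.trans hε₀π⟩
    calc m θ * L ≤ m θ * ((θ / ε) ^ α / (α * Real.exp 1)) := by gcongr
      _ = (c * α * Real.exp 1)⁻¹ * (c * (θ / ε) ^ α * m θ) := by field_simp
      _ ≤ (c * α * Real.exp 1)⁻¹ * m ε := by
        gcongr
        exact rpow_mul_le_of_recipPosIncrease hε₀π hmpos hrpi hε0 h₁ h₂
  refine csSup_le ((Set.nonempty_Icc.2 (hεε₀.trans hε₀π)).image _) ?_
  rintro _ ⟨θ, ⟨hεθ, hθπ⟩, rfl⟩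
  have hθ0 : 0 < θ := hε0.trans_le hεθ
  rcases le_total θ ε₀ with hθ | hθ
  · exact hreduce θ hεθ hθ _ (log_le_rpow_div_mul_exp_one hα (div_pos hθ0 hε0))
  · have hlog' : Real.log (Real.pi / ε) ≤ (ε₀ / ε) ^ α / (α * Real.exp 1) := by
      rwa [div_mul_eq_mul_div, ← Real.mul_rpow (by positivity) (by positivity),
        div_mul_div_cancel₀ Real.pi_ne_zero] at hlog
    refine le_trans ?_ (hreduce ε₀ hεε₀ le_rfl _ hlog')
    have hm : m θ ≤ m ε₀ := hmanti ⟨hε₀0, hε₀π⟩ ⟨hθ0, hθπ⟩ hθ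
    have hm₀ := hmpos ε₀ ⟨hε₀0, hε₀π⟩
    have hlog0 : 0 ≤ Real.log (θ / ε) := Real.log_nonneg ((one_le_div hε0).2 hεθ)
    dsimp only
    gcongr

/-- If `M ≤ K m` near `0` and `m` has reciprocally positive increase, then
`M⁻¹(n) = O(m⁻¹(n))`. -/
lemma exists_eventually_rightInv_le {m M : ℝ → ℝ} {c α ε₀ K : ℝ}
    (hmpos : ∀ ε ∈ Set.Ioc (0:ℝ) Real.pi, 0 < m ε)
    (hc : 0 < c) (hα : 0 < α) (hε₀ : ε₀ ∈ Set.Ioc (0:ℝ) Real.pi)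
    (hrpi : ∀ t ≥ (1:ℝ), ∀ ε ∈ Set.Ioc (0:ℝ) ε₀, c * t ^ α ≤ m (ε / t) / m ε)
    (hM : ∀ᶠ ε in 𝓝[>] (0 : ℝ), M ε ≤ K * m ε) :
    ∃ C > (0:ℝ), ∀ᶠ n : ℕ in atTop, rightInv M n ≤ C * rightInv m n := by
  obtain ⟨hε₀0, hε₀π⟩ := hε₀
  obtain ⟨C, hCK, hC1⟩ := (((tendsto_rpow_atTop hα).eventually_ge_atTop (K / c)).and
    (eventually_ge_atTop 1)).exists
  have hC0 : 0 < C := zero_lt_one.trans_le hC1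
  obtain ⟨δ, hδ0, hδ⟩ := mem_nhdsGT_iff_exists_Ioc_subset.1
    (hM.and (Ioc_mem_nhdsGT hε₀0))
  replace hδ : ∀ η, 0 < η → η ≤ δ → M η ≤ K * m η ∧ η ≤ ε₀ := fun η h₁ h₂ =>
    ⟨(hδ ⟨h₁, h₂⟩).1, (hδ ⟨h₁, h₂⟩).2.2⟩
  have hδC : 0 < δ / C := div_pos hδ0 hC0
  have hsmall : ∀ (s ε : ℝ), 0 < ε → ε ≤ δ / C → m ε ≤ s → rightInv M s ≤ C * ε := by
    intro s ε hε0 hε hs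
    have hη0 : 0 < C * ε := mul_pos hC0 hε0
    obtain ⟨hMη, hηε₀⟩ := hδ (C * ε) hη0 (by rwa [le_div_iff₀' hC0] at hε)
    have hη : C * ε ∈ Set.Ioc 0 Real.pi := ⟨hη0, hηε₀.trans hε₀π⟩
    have hmη := hmpos _ hη
    refine rightInv_le hη (hMη.trans (le_trans ?_ hs))
    have hinc := rpow_mul_le_of_recipPosIncrease hε₀π hmpos hrpi hε0
      (le_mul_of_one_le_left hε0.le hC1) hηε₀
    rw [mul_div_cancel_right₀ _ hε0.ne'] at hinc
    refine le_trans ?_ hinc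
    gcongr
    rwa [div_le_iff₀' hc] at hCK
  have hδCπ : δ / C ≤ Real.pi :=
    (div_le_self hδ0.le hC1).trans ((hδ δ hδ0 le_rfl).2.trans hε₀π)
  refine ⟨C, hC0, ?_⟩
  filter_upwards [tendsto_natCast_atTop_atTop.eventually_ge_atTop (m (δ / C))] with n hn
  rw [← div_le_iff₀' hC0]
  refine le_csInf ⟨δ / C, ⟨hδC, hδCπ⟩, hn⟩ ?_
  rintro ε ⟨⟨hε0, -⟩, hεn⟩
  rw [div_le_iff₀' hC0]
  rcases le_total ε (δ / C) with h | h
  · exact hsmall n ε hε0 h hεn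
  · exact (hsmall n _ hδC le_rfl hn).trans (by gcongr)

/-- If `m` has reciprocally positive increase with constants `c, α, ε₀`, then
`m_max(ε) ≤ (cαe)⁻¹ m(ε)` for all sufficiently small `ε`, and consequently
`m_max⁻¹(n) = O(m⁻¹(n))` as `n → ∞`. -/
theorem mMax_le_of_recipPosIncrease (m : ℝ → ℝ)
    (hmc : ContinuousOn m (Set.Ioc 0 Real.pi))
    (hmanti : AntitoneOn m (Set.Ioc 0 Real.pi))
    (hmpos : ∀ ε ∈ Set.Ioc (0:ℝ) Real.pi, 0 < m ε)
    (hminf : Filter.Tendsto m (nhdsWithin 0 (Set.Ioi 0)) Filter.atTop)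
    (c : ℝ) (hc : c ∈ Set.Ioc (0:ℝ) 1) (α : ℝ) (hα : 0 < α)
    (ε₀ : ℝ) (hε₀ : ε₀ ∈ Set.Ioc (0:ℝ) Real.pi)
    (hrpi : ∀ t ≥ (1:ℝ), ∀ ε ∈ Set.Ioc (0:ℝ) ε₀, c * t ^ α ≤ m (ε / t) / m ε) :
    (∀ᶠ ε in nhdsWithin (0:ℝ) (Set.Ioi 0),
      mMax m ε ≤ (c * α * Real.exp 1)⁻¹ * m ε) ∧
    (∃ C > (0:ℝ), ∀ᶠ n : ℕ in Filter.atTop,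
      rightInv (mMax m) n ≤ C * rightInv m n) := by
  have h := eventually_mMax_le hmanti hmpos hc.1 hα hε₀ hrpi
  exact ⟨h, exists_eventually_rightInv_le hmpos hc.1 hα hε₀ hrpi h⟩
end

section
/- Let m : (0,π] → (0,∞) be continuous and non-increasing with m(ε) → ∞ as ε → 0+. Then for any c, c' > 0 one has m_max⁻¹(cn) ≥ e^{−c/c'} m⁻¹(c'n) for all sufficiently large n ≥ 1. -/
open Filter Topology

theorem rightInv_nonneg (M : ℝ → ℝ) (s : ℝ) : 0 ≤ rightInv M s :=
  Real.sInf_nonneg fun _ hx => hx.1.1.le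

theorem rightInv_le_pi (M : ℝ → ℝ) (s : ℝ) : rightInv M s ≤ Real.pi := by
  rcases Set.eq_empty_or_nonempty {ε : ℝ | ε ∈ Set.Ioc 0 Real.pi ∧ M ε ≤ s} with h | ⟨x, hx⟩
  · rw [rightInv, h, Real.sInf_empty]
    exact Real.pi_pos.le
  · exact (csInf_le ⟨0, fun _ hy => hy.1.1.le⟩ hx).trans hx.1.2

theorem lt_of_lt_rightInv {M : ℝ → ℝ} {s θ : ℝ} (hθ : 0 < θ) (h : θ < rightInv M s) :
    s < M θ := by
  by_contra! hs
  exact h.not_ge <| csInf_le ⟨0, fun _ hy => hy.1.1.le⟩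
    ⟨⟨hθ, h.le.trans (rightInv_le_pi M s)⟩, hs⟩

theorem mul_log_le_mMax_s14 {m : ℝ → ℝ} (hmanti : AntitoneOn m (Set.Ioc 0 Real.pi))
    (hmpos : ∀ ε ∈ Set.Ioc (0:ℝ) Real.pi, 0 < m ε) {ε θ : ℝ} (hε : 0 < ε)
    (hθ : θ ∈ Set.Icc ε Real.pi) : m θ * Real.log (θ / ε) ≤ mMax m ε := by
  refine le_csSup ⟨m ε * Real.log (Real.pi / ε), ?_⟩ (Set.mem_image_of_mem _ hθ)
  rintro _ ⟨x, ⟨hεx, hxπ⟩, rfl⟩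
  have hεmem : ε ∈ Set.Ioc 0 Real.pi := ⟨hε, hεx.trans hxπ⟩
  have hx : 0 < x := hε.trans_le hεx
  exact mul_le_mul (hmanti hεmem ⟨hx, hxπ⟩ hεx)
    (Real.log_le_log (div_pos hx hε) (by gcongr))
    (Real.log_nonneg ((one_le_div hε).2 hεx)) (hmpos ε hεmem).le

theorem mMax_pi (m : ℝ → ℝ) : mMax m Real.pi = 0 := by
  simp [mMax, Real.pi_ne_zero]

/-- For any `c, c' > 0`, `m_max⁻¹(cn) ≥ e^{-c/c'} m⁻¹(c'n)` for all sufficiently large `n`. -/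
theorem mMaxInv_ge (m : ℝ → ℝ)
    (hmc : ContinuousOn m (Set.Ioc 0 Real.pi))
    (hmanti : AntitoneOn m (Set.Ioc 0 Real.pi))
    (hmpos : ∀ ε ∈ Set.Ioc (0:ℝ) Real.pi, 0 < m ε)
    (hminf : Filter.Tendsto m (nhdsWithin 0 (Set.Ioi 0)) Filter.atTop)
    (c c' : ℝ) (hc : 0 < c) (hc' : 0 < c') :
    ∀ᶠ n : ℕ in Filter.atTop,
      Real.exp (-(c / c')) * rightInv m (c' * n) ≤ rightInv (mMax m) (c * n) := by
  refine Eventually.of_forall fun n => ?_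
  have hn : (0 : ℝ) ≤ n := n.cast_nonneg
  refine le_csInf ⟨Real.pi, ⟨Real.pi_pos, le_rfl⟩, by rw [mMax_pi]; positivity⟩ ?_
  rintro ε ⟨⟨hε, -⟩, hM⟩
  by_contra! hlt
  have hlt' : ε * Real.exp (c / c') < rightInv m (c' * n) := by
    rw [Real.exp_neg, inv_mul_eq_div, lt_div_iff₀ (Real.exp_pos _)] at hlt
    exact hlt
  obtain ⟨θ, hεθ, hθ⟩ := exists_between hlt'
  have hr : 0 < c / c' := div_pos hc hc'
  have hle : ε ≤ θ := (le_mul_of_one_le_right hε.le (Real.one_le_exp hr.le)).trans hεθ.le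
  have hθpos : 0 < θ := hε.trans_le hle
  have hm : c' * n < m θ := lt_of_lt_rightInv hθpos hθ
  have hlog : c / c' < Real.log (θ / ε) := by
    rw [Real.lt_log_iff_exp_lt (div_pos hθpos hε), lt_div_iff₀ hε, mul_comm]
    exact hεθ
  have hmul : c' * n * (c / c') < m θ * Real.log (θ / ε) :=
    mul_lt_mul hm hlog.le hr ((by positivity : (0 : ℝ) ≤ c' * n).trans hm.le)
  have heq : c' * n * (c / c') = c * n := by field_simp
  have hmax := mul_log_le_mMax_s14 hmanti hmpos hε ⟨hle, hθ.le.trans (rightInv_le_pi m _)⟩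
  linarith
end
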